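/- Let σ: Ω → Ω be an invertible, mixing, ℙ-preserving transformation and let (P,σ) be a Markov operator cocycle induced by Perron–Frobenius operators P_ω = L_{T_ω} with invariant density map h_ω (μ_ω = h_ω m). If (P,σ) is prior mixing for inhomogeneous observables in B(Ω, L^∞(X,m)), then the skew product Θ(ω,x) = (σω, T_ω x) is mixing with respect to ν: for all A, B ∈ ℱ ⊗ 𝒜, ν(Θ^{−n}A ∩ B) → ν(A)ν(B) as n → ∞. -/

import Mathlib

open MeasureTheory Filter Topology ProbabilityTheory

/-- The cocycle `P_ω^{(n)} = P_{σ^{n-1}ω} ∘ ⋯ ∘ P_ω` generated by a family of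
operators over the driving system `σ`. -/
noncomputable def coc {Ω M : Type*} [Monoid M] (P : Ω → M) (σ : Ω → Ω) : ℕ → Ω → M
  | 0, _ => 1
  | n + 1, ω => P (σ^[n] ω) * coc P σ n ω


/-- Density argument: uniformly bounded linear functionals tending to zero on indicators. -/
lemma aux_density {Ω : Type*} [MeasurableSpace Ω] (Pr : Measure Ω) [IsProbabilityMeasure Pr]
    (D : ℕ → (Ω → ℝ) → ℝ) (C : ℝ)
    (hadd : ∀ n f g, Integrable f Pr → Integrable g Pr → D n (f + g) = D n f + D n g)
    (hsmul : ∀ n (c : ℝ) f, Integrable f Pr → D n (c • f) = c * D n f)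
    (hbd : ∀ n f, Integrable f Pr → |D n f| ≤ C * ∫ x, |f x| ∂Pr)
    (hind : ∀ F, MeasurableSet F → Tendsto (fun n => D n (F.indicator 1)) atTop (𝓝 0))
    (f : Ω → ℝ) (hf : Integrable f Pr) : Tendsto (fun n => D n f) atTop (𝓝 0) := by
  have hC : 0 ≤ C := by
    have h1 := (abs_nonneg _).trans (hbd 0 (fun _ => 1) (integrable_const _))
    simpa using h1
  have hsub : ∀ n f g, Integrable f Pr → Integrable g Pr → D n f = D n g + D n (f - g) := by
    intro n f g hf hg
    rw [← hadd n g (f - g) hg (hf.sub hg)]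
    congr 1
    ext x; simp
  refine Integrable.induction (fun f => Tendsto (fun n => D n f) atTop (𝓝 0)) ?_ ?_ ?_ ?_ hf
  · intro c s hs _
    have : (s.indicator fun _ => c) = c • (s.indicator (1 : Ω → ℝ)) := by
      ext x; by_cases hx : x ∈ s <;> simp [hx]
    rw [this]
    have h1 := (hind s hs).const_mul c
    rw [mul_zero] at h1
    refine h1.congr fun n => ?_
    rw [hsmul]
    exact (integrable_const (1 : ℝ)).indicator hs
  · intro f g _ hf hg h1 h2
    have := h1.add h2
    rw [add_zero] at this
    exact this.congr fun n => (hadd n f g hf hg).symm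
  · rw [← isSeqClosed_iff_isClosed]
    intro u f hu huf
    rw [Set.mem_ofPred_eq, Metric.tendsto_atTop]
    intro ε hε
    have hδ : 0 < ε / (2 * (C + 1)) := by positivity
    obtain ⟨k, hk⟩ := (Metric.tendsto_atTop.1 huf) _ hδ
    have hk := hk k le_rfl
    obtain ⟨N, hN⟩ := (Metric.tendsto_atTop.1 (hu k)) (ε / 2) (by positivity)
    refine ⟨N, fun n hn => ?_⟩
    have h1 := hN n hn
    rw [Real.dist_eq, sub_zero] at h1 ⊢
    have hfi := L1.integrable_coeFn f
    have hui := L1.integrable_coeFn (u k)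
    rw [hsub n f (u k) hfi hui]
    have h2 := hbd n _ (hfi.sub hui)
    have h3 : ∫ x, |(⇑f - ⇑(u k)) x| ∂Pr = dist (u k) f := by
      rw [dist_comm, dist_eq_norm, L1.norm_eq_integral_norm]
      refine integral_congr_ae ?_
      filter_upwards [Lp.coeFn_sub f (u k)] with x hx
      rw [hx, Real.norm_eq_abs]
    rw [h3] at h2
    have h4 : C * dist (u k) f ≤ ε / 2 := by
      have : C * dist (u k) f ≤ (C + 1) * (ε / (2 * (C + 1))) := by
        gcongr
        linarith
      refine this.trans (le_of_eq ?_)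
      field_simp
    calc _ ≤ |D n (u k)| + |D n (⇑f - ⇑(u k))| := abs_add_le _ _
      _ < ε := by linarith
  · intro f g hfg hf h1
    refine h1.congr fun n => ?_
    have hg := hf.congr hfg
    have h2 := hbd n _ (hf.sub hg)
    have h3 : ∫ x, |(f - g) x| ∂Pr = 0 := by
      rw [integral_eq_zero_of_ae]
      filter_upwards [hfg] with x hx
      simp [hx]
    rw [h3, mul_zero] at h2
    rw [hsub n f g hf hg, abs_nonpos_iff.1 h2, add_zero]

/-- Mixing for bounded functions. -/
lemma aux_mixing {Ω : Type*} [MeasurableSpace Ω] (Pr : Measure Ω) [IsProbabilityMeasure Pr]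
    (σ : Ω → Ω) (hσ : MeasurePreserving σ Pr Pr)
    (hσmix : ∀ F G : Set Ω, MeasurableSet F → MeasurableSet G →
      Tendsto (fun n => Pr (σ^[n] ⁻¹' F ∩ G)) atTop (𝓝 (Pr F * Pr G)))
    (φ ψ : Ω → ℝ) (hφ : Measurable φ) (hψ : Measurable ψ)
    (hφb : ∀ x, |φ x| ≤ 1) (hψb : ∀ x, |ψ x| ≤ 1) :
    Tendsto (fun n => ∫ x, φ (σ^[n] x) * ψ x ∂Pr) atTop
      (𝓝 ((∫ x, φ x ∂Pr) * ∫ x, ψ x ∂Pr)) := by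
  have hint : ∀ g : Ω → ℝ, Measurable g → (∀ x, |g x| ≤ 1) → Integrable g Pr := fun g hg hb =>
    Integrable.of_bound hg.aestronglyMeasurable 1 (ae_of_all _ hb)
  have habs : ∀ g : Ω → ℝ, Integrable g Pr → |∫ x, g x ∂Pr| ≤ ∫ x, |g x| ∂Pr :=
    fun g _ => abs_integral_le_integral_abs
  -- the second function
  have step1 : ∀ F, MeasurableSet F → ∀ g, Integrable g Pr →
      Tendsto (fun n => ∫ x, F.indicator 1 (σ^[n] x) * g x ∂Pr - Pr.real F * ∫ x, g x ∂Pr)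
        atTop (𝓝 0) := by
    intro F hF g hg
    have hm : ∀ n, Measurable fun x => (F.indicator 1 (σ^[n] x) : ℝ) := fun n =>
      (measurable_one.indicator hF).comp (hσ.iterate n).measurable
    have hb : ∀ n x, ‖(F.indicator 1 (σ^[n] x) : ℝ)‖ ≤ 1 := by
      intro n x
      by_cases hx : σ^[n] x ∈ F <;> simp [hx]
    have hi : ∀ n (g : Ω → ℝ), Integrable g Pr →
        Integrable (fun x => F.indicator 1 (σ^[n] x) * g x) Pr := fun n g hg =>
      hg.bdd_mul (hm n).aestronglyMeasurable (ae_of_all _ (hb n))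
    refine aux_density Pr (fun n g => ∫ x, F.indicator 1 (σ^[n] x) * g x ∂Pr
      - Pr.real F * ∫ x, g x ∂Pr) 2 ?_ ?_ ?_ ?_ g hg
    · intro n f g hf hg
      simp only [Pi.add_apply, mul_add]
      rw [integral_add (hi n f hf) (hi n g hg), integral_add hf hg]
      ring
    · intro n c f hf
      simp only [Pi.smul_apply, smul_eq_mul, mul_left_comm _ c]
      rw [integral_const_mul, integral_const_mul]
      ring
    · intro n f hf
      have h1 : |∫ x, F.indicator 1 (σ^[n] x) * f x ∂Pr| ≤ ∫ x, |f x| ∂Pr := by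
        refine abs_integral_le_integral_abs.trans
          (integral_mono (hi n f hf).abs hf.abs fun x => ?_)
        have := hb n x
        rw [Real.norm_eq_abs] at this
        simp only [abs_mul]
        exact mul_le_of_le_one_left (abs_nonneg _) this
      have h2 : |Pr.real F * ∫ x, f x ∂Pr| ≤ ∫ x, |f x| ∂Pr := by
        rw [abs_mul, abs_of_nonneg measureReal_nonneg]
        exact (mul_le_of_le_one_left (abs_nonneg _) measureReal_le_one).trans (habs f hf)
      have := abs_sub (∫ x, F.indicator 1 (σ^[n] x) * f x ∂Pr) (Pr.real F * ∫ x, f x ∂Pr)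
      linarith
    · intro G hG
      have h1 := (ENNReal.tendsto_toReal (by finiteness)).comp (hσmix F G hF hG)
      have h2 := h1.sub_const ((Pr F * Pr G).toReal)
      rw [sub_self] at h2
      refine h2.congr fun n => ?_
      have : ∀ x, F.indicator 1 (σ^[n] x) * G.indicator 1 x
          = (σ^[n] ⁻¹' F ∩ G).indicator (1 : Ω → ℝ) x := by
        intro x
        by_cases hx : σ^[n] x ∈ F <;> by_cases hy : x ∈ G <;> simp [hx, hy, Set.indicator]
      simp only [this]
      rw [integral_indicator_one (((hσ.iterate n).measurable hF).inter hG),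
        integral_indicator_one hG, ENNReal.toReal_mul]
      rfl
  have hψi := hint ψ hψ hψb
  have hi : ∀ n (g : Ω → ℝ), Integrable g Pr → Integrable (fun x => g (σ^[n] x) * ψ x) Pr :=
    fun n g hg => ((hσ.iterate n).integrable_comp_of_integrable hg).mul_bdd
      hψ.aestronglyMeasurable (ae_of_all _ hψb)
  have hcomp : ∀ n (g : Ω → ℝ), Integrable g Pr → ∫ x, g (σ^[n] x) ∂Pr = ∫ x, g x ∂Pr := by
    intro n g hg
    have h1 := (hσ.iterate n).map_eq
    conv_rhs => rw [← h1]
    rw [integral_map (hσ.iterate n).measurable.aemeasurable]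
    rw [h1]; exact hg.aestronglyMeasurable
  have step2 := aux_density Pr (fun n g => ∫ x, g (σ^[n] x) * ψ x ∂Pr
      - (∫ x, g x ∂Pr) * ∫ x, ψ x ∂Pr) 2 ?_ ?_ ?_ ?_ φ (hint φ hφ hφb)
  · have := step2.add_const ((∫ x, φ x ∂Pr) * ∫ x, ψ x ∂Pr)
    simpa using this
  · intro n f g hf hg
    simp only [Pi.add_apply, add_mul]
    rw [integral_add (hi n f hf) (hi n g hg), integral_add hf hg]
    ring
  · intro n c f hf
    simp only [Pi.smul_apply, smul_eq_mul, mul_assoc]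
    rw [integral_const_mul, integral_const_mul]
    ring
  · intro n f hf
    have h1 : |∫ x, f (σ^[n] x) * ψ x ∂Pr| ≤ ∫ x, |f x| ∂Pr := by
      rw [← hcomp n _ hf.abs]
      refine abs_integral_le_integral_abs.trans
        (integral_mono (hi n f hf).abs
          ((hσ.iterate n).integrable_comp_of_integrable hf.abs) fun x => ?_)
      simp only [abs_mul]
      exact mul_le_of_le_one_right (abs_nonneg _) (hψb x)
    have h3 : |∫ x, ψ x ∂Pr| ≤ 1 := by
      refine (habs ψ hψi).trans ((integral_mono hψi.abs (integrable_const 1) hψb).trans ?_)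
      simp
    have h2 : |(∫ x, f x ∂Pr) * ∫ x, ψ x ∂Pr| ≤ ∫ x, |f x| ∂Pr := by
      rw [abs_mul]
      exact (mul_le_of_le_one_right (abs_nonneg _) h3).trans (habs f hf)
    have := abs_sub (∫ x, f (σ^[n] x) * ψ x ∂Pr) ((∫ x, f x ∂Pr) * ∫ x, ψ x ∂Pr)
    linarith
  · intro F hF
    simpa [integral_indicator_one hF] using step1 F hF ψ hψi

/-- Perron–Frobenius duality on sets. -/
lemma aux_dual {X : Type*} [MeasurableSpace X] (m : Measure X) [IsProbabilityMeasure m]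
    (T : X → X) (hT : Measurable T) (hns : Measure.map T m ≪ m)
    (P : Module.End ℝ (Lp ℝ 1 m))
    (hPF : ∀ (f : Lp ℝ 1 m) (u : Lp ℝ ⊤ m),
      ∫ x, (P f) x * u x ∂m = ∫ x, f x * u (T x) ∂m)
    (f : Lp ℝ 1 m) (E : Set X) (hE : MeasurableSet E) :
    ∫ x in E, (P f) x ∂m = ∫ x in T ⁻¹' E, f x ∂m := by
  have h1 := hPF f (indicatorConstLp ⊤ hE (measure_ne_top m E) (1 : ℝ))
  have h2 : ∀ᵐ x ∂m, (indicatorConstLp ⊤ hE (measure_ne_top m E) (1 : ℝ)) x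
      = E.indicator (fun _ => (1 : ℝ)) x := indicatorConstLp_coeFn
  have h3 := (Measure.QuasiMeasurePreserving.mk hT hns).ae h2
  rw [← integral_indicator hE, ← integral_indicator (hT hE)]
  calc _ = ∫ x, (P f) x * (indicatorConstLp ⊤ hE (measure_ne_top m E) (1 : ℝ)) x ∂m := by
        refine integral_congr_ae ?_
        filter_upwards [h2] with x hx
        rw [hx]; by_cases h : x ∈ E <;> simp [h]
    _ = _ := h1
    _ = _ := by
        refine integral_congr_ae ?_
        filter_upwards [h3] with x hx
        rw [hx]; by_cases h : T x ∈ E <;> simp [h]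

/-- Let `σ` be invertible, mixing and measure preserving, and let `(P,σ)` be a
Markov operator cocycle induced by Perron–Frobenius operators `P_ω = L_{T_ω}`
with invariant density map `h` (`μ_ω = h_ω m`). If `(P,σ)` is prior mixing for
inhomogeneous observables in `B(Ω, L^∞(X,m))`, then the skew product
`Θ(ω,x) = (σω, T_ω x)` is mixing for `ν = ∫ μ_ω dℙ`:
`ν(Θ⁻ⁿA ∩ B) → ν(A)ν(B)`. -/
theorem prior_mixing_implies_skew_product_mixing
    {X : Type*} [MeasurableSpace X] (m : Measure X) [IsProbabilityMeasure m]
    {Ω : Type*} [MeasurableSpace Ω] (Pr : Measure Ω) [IsProbabilityMeasure Pr]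
    (σ : Ω → Ω) (hσ : MeasurePreserving σ Pr Pr) (hσbij : Function.Bijective σ)
    -- σ is mixing:
    (hσmix : ∀ F G : Set Ω, MeasurableSet F → MeasurableSet G →
      Tendsto (fun n => Pr (σ^[n] ⁻¹' F ∩ G)) atTop (𝓝 (Pr F * Pr G)))
    (T : Ω → X → X) (hTmeas : Measurable (Function.uncurry T))
    (hns : ∀ ω, Measure.map (T ω) m ≪ m)
    -- the Markov operator cocycle of Perron–Frobenius operators:
    (P : Ω → Module.End ℝ (Lp ℝ 1 m))
    (hP : ∀ᵐ ω ∂Pr, (∀ f : Lp ℝ 1 m, 0 ≤ f → 0 ≤ P ω f) ∧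
      ∀ f : Lp ℝ 1 m, ∫ x, (P ω f) x ∂m = ∫ x, f x ∂m)
    (hPF : ∀ (ω : Ω) (f : Lp ℝ 1 m) (u : Lp ℝ ⊤ m),
      ∫ x, (P ω f) x * u x ∂m = ∫ x, f x * u (T ω x) ∂m)
    -- invariant density map h and the measures μ_ω = h_ω m as a Markov kernel:
    (h : Ω → Lp ℝ 1 m)
    (hdens : ∀ᵐ ω ∂Pr, 0 ≤ h ω ∧ ∫ x, (h ω) x ∂m = 1)
    (hinv : ∀ᵐ ω ∂Pr, P ω (h ω) = h (σ ω))
    (κ : Kernel Ω X) [IsMarkovKernel κ]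
    (hκ : ∀ ω, κ ω = m.withDensity (fun x => ENNReal.ofReal ((h ω) x)))
    -- prior mixing for inhomogeneous observables in B(Ω, L^∞(X,m)):
    (hmix : ∀ᵐ ω ∂Pr, ∀ (f : Lp ℝ 1 m), ∫ x, f x ∂m = 0 →
      ∀ (G : Ω → Lp ℝ ⊤ m), StronglyMeasurable G → (∃ C : ℝ, ∀ ω', ‖G ω'‖ ≤ C) →
        Tendsto (fun n => ∫ x, (coc P σ n ω f) x * (G (σ^[n] ω)) x ∂m)
          atTop (𝓝 0)) :
    ∀ A B : Set (Ω × X), MeasurableSet A → MeasurableSet B →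
      Tendsto
        (fun n => (Pr.compProd κ)
          ((fun p : Ω × X => (σ p.1, T p.1 p.2))^[n] ⁻¹' A ∩ B))
        atTop (𝓝 ((Pr.compProd κ) A * (Pr.compProd κ) B)) := by
  classical
  intro A B hA hB
  set Θ : Ω × X → Ω × X := fun p => (σ p.1, T p.1 p.2) with hΘdef
  have hΘ : Measurable Θ := (hσ.measurable.comp measurable_fst).prodMk hTmeas
  have hΘn : ∀ n, Measurable Θ^[n] := fun n => hΘ.iterate n
  set Tn : ℕ → Ω → X → X := fun n ω x => (Θ^[n] (ω, x)).2 with hTn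
  have hΘfst : ∀ n ω x, (Θ^[n] (ω, x)).1 = σ^[n] ω := by
    intro n ω x
    induction n with
    | zero => rfl
    | succ k ih =>
      rw [Function.iterate_succ_apply', Function.iterate_succ_apply', ← ih]
  have hΘeq : ∀ n ω x, Θ^[n] (ω, x) = (σ^[n] ω, Tn n ω x) := fun n ω x =>
    Prod.ext (hΘfst n ω x) rfl
  have hTsucc : ∀ n ω x, Tn (n + 1) ω x = T (σ^[n] ω) (Tn n ω x) := by
    intro n ω x
    simp only [hTn]
    rw [Function.iterate_succ_apply', hΘeq]
  have hTω : ∀ ω, Measurable (T ω) := fun ω => hTmeas.comp measurable_prodMk_left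
  have hTnω : ∀ n ω, Measurable (Tn n ω) := fun n ω =>
    measurable_snd.comp ((hΘn n).comp measurable_prodMk_left)
  -- duality for the cocycle
  have hdual : ∀ n ω (f : Lp ℝ 1 m) (E : Set X), MeasurableSet E →
      ∫ x in E, (coc P σ n ω f) x ∂m = ∫ x in Tn n ω ⁻¹' E, f x ∂m := by
    intro n ω f
    induction n with
    | zero => intro E hE; rfl
    | succ k ih =>
      intro E hE
      have h1 : coc P σ (k + 1) ω f = P (σ^[k] ω) (coc P σ k ω f) := rfl
      rw [h1, aux_dual m _ (hTω _) (hns _) (P (σ^[k] ω)) (hPF _) _ E hE, ih _ (hTω _ hE)]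
      congr 2
      ext x
      simp only [Set.mem_preimage, hTsucc]
  -- good set of ω
  have hgood : ∀ᵐ ω ∂Pr, ∀ n, 0 ≤ h (σ^[n] ω) ∧ P (σ^[n] ω) (h (σ^[n] ω)) = h (σ (σ^[n] ω)) := by
    rw [ae_all_iff]
    intro n
    refine (hσ.iterate n).quasiMeasurePreserving.ae
      (p := fun ω => 0 ≤ h ω ∧ P ω (h ω) = h (σ ω)) ?_
    filter_upwards [hdens, hinv] with ω h1 h2
    exact ⟨h1.1, h2⟩
  have hcoch : ∀ ω, (∀ n, 0 ≤ h (σ^[n] ω) ∧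
      P (σ^[n] ω) (h (σ^[n] ω)) = h (σ (σ^[n] ω))) → ∀ n, coc P σ n ω (h ω) = h (σ^[n] ω) := by
    intro ω hω n
    induction n with
    | zero => rfl
    | succ k ih =>
      have h1 : coc P σ (k + 1) ω (h ω) = P (σ^[k] ω) (coc P σ k ω (h ω)) := rfl
      rw [h1, ih, (hω k).2, Function.iterate_succ_apply']
  have hκr : ∀ ω, 0 ≤ h ω → ∀ E, MeasurableSet E → (κ ω).real E = ∫ x in E, (h ω) x ∂m := by
    intro ω hω E hE
    have h0 : 0 ≤ᵐ[m] (h ω : X → ℝ) := (Lp.coeFn_nonneg _).2 hω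
    rw [Measure.real, hκ, withDensity_apply _ hE,
      integral_eq_lintegral_of_nonneg_ae (ae_restrict_of_ae h0)
        (L1.integrable_coeFn (h ω)).aestronglyMeasurable.restrict]
  have hinvκ : ∀ᵐ ω ∂Pr, ∀ n E, MeasurableSet E →
      (κ ω).real (Tn n ω ⁻¹' E) = (κ (σ^[n] ω)).real E := by
    filter_upwards [hgood] with ω hω n E hE
    rw [hκr _ (hω n).1 E hE, hκr ω (hω 0).1 _ (hTnω n ω hE), ← hcoch ω hω n, hdual n ω _ E hE]
  -- sections
  set sec : Set (Ω × X) → Ω → ℝ := fun S ω => (κ ω).real (Prod.mk ω ⁻¹' S) with hsec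
  have hsecm : ∀ S, MeasurableSet S → Measurable (sec S) := fun S hS =>
    (Kernel.measurable_kernel_prodMk_left hS).ennreal_toReal
  have hsecb : ∀ S ω, |sec S ω| ≤ 1 := by
    intro S ω
    rw [abs_of_nonneg measureReal_nonneg]
    exact measureReal_le_one
  have hseci : ∀ S, MeasurableSet S → Integrable (sec S) Pr := fun S hS =>
    Integrable.of_bound (hsecm S hS).aestronglyMeasurable 1 (ae_of_all _ (hsecb S))
  have hν : ∀ S, MeasurableSet S → (Pr.compProd κ).real S = ∫ ω, sec S ω ∂Pr := by
    intro S hS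
    rw [Measure.real, Measure.compProd_apply hS]
    exact (integral_toReal (Kernel.measurable_kernel_prodMk_left hS).aemeasurable
      (ae_of_all _ fun ω => measure_lt_top _ _)).symm
  have hsecΘ : ∀ S n ω, Prod.mk ω ⁻¹' (Θ^[n] ⁻¹' S) = Tn n ω ⁻¹' (Prod.mk (σ^[n] ω) ⁻¹' S) := by
    intro S n ω
    ext x
    simp only [Set.mem_preimage, hΘeq]
  -- invariance of ν
  have hνinv : ∀ n S, MeasurableSet S →
      (Pr.compProd κ).real (Θ^[n] ⁻¹' S) = (Pr.compProd κ).real S := by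
    intro n S hS
    rw [hν _ (hΘn n hS), hν S hS]
    have h1 : ∫ ω, sec S (σ^[n] ω) ∂Pr = ∫ ω, sec S ω ∂Pr := by
      have h1 := (hσ.iterate n).map_eq
      conv_rhs => rw [← h1]
      rw [integral_map (hσ.iterate n).measurable.aemeasurable
        (hsecm S hS).aestronglyMeasurable]
    rw [← h1]
    refine integral_congr_ae ?_
    filter_upwards [hinvκ] with ω hω
    simp only [hsec]
    rw [hsecΘ, hω n _ (measurable_prodMk_left hS)]
  -- reduction to reals
  suffices hreal : Tendsto (fun n => (Pr.compProd κ).real (Θ^[n] ⁻¹' A ∩ B)) atTop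
      (𝓝 ((Pr.compProd κ).real A * (Pr.compProd κ).real B)) by
    rw [← ENNReal.tendsto_toReal_iff (fun n => measure_ne_top _ _) (by finiteness),
      ENNReal.toReal_mul]
    exact hreal
  induction A, hA using MeasurableSpace.induction_on_inter generateFrom_prod.symm
    isPiSystem_prod with
  | empty => simp
  | basic A hA =>
    obtain ⟨F, hF, E, hE, rfl⟩ := hA
    have hF : MeasurableSet F := hF
    have hE : MeasurableSet E := hE
    have hFE := hF.prod hE
    have hmeasn : ∀ n, MeasurableSet (Θ^[n] ⁻¹' (F ×ˢ E) ∩ B) := fun n => (hΘn n hFE).inter hB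
    have hM := aux_mixing Pr σ hσ hσmix (sec (F ×ˢ E)) (sec B) (hsecm _ hFE) (hsecm _ hB)
      (hsecb _) (hsecb _)
    rw [← hν _ hFE, ← hν _ hB] at hM
    have hprodm : ∀ n, Measurable fun ω => sec (F ×ˢ E) (σ^[n] ω) * sec B ω := fun n =>
      ((hsecm _ hFE).comp (hσ.iterate n).measurable).mul (hsecm _ hB)
    have hprodb : ∀ n ω, |sec (F ×ˢ E) (σ^[n] ω) * sec B ω| ≤ 1 := by
      intro n ω
      rw [abs_mul]
      exact mul_le_one₀ (hsecb _ _) (abs_nonneg _) (hsecb _ _)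
    have hprodi : ∀ n, Integrable (fun ω => sec (F ×ˢ E) (σ^[n] ω) * sec B ω) Pr := fun n =>
      Integrable.of_bound (hprodm n).aestronglyMeasurable 1 (ae_of_all _ (hprodb n))
    have hD : Tendsto (fun n => ∫ ω, (sec (Θ^[n] ⁻¹' (F ×ˢ E) ∩ B) ω
        - sec (F ×ˢ E) (σ^[n] ω) * sec B ω) ∂Pr) atTop (𝓝 0) := by
      have h0 : (0 : ℝ) = ∫ ω, (0 : ℝ) ∂Pr := by simp
      rw [h0]
      refine tendsto_integral_of_dominated_convergence (fun _ => 2)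
        (fun n => ((hsecm _ (hmeasn n)).sub (hprodm n)).aestronglyMeasurable)
        (integrable_const _) (fun n => ae_of_all _ fun ω => ?_) ?_
      · have h1 := hsecb (Θ^[n] ⁻¹' (F ×ˢ E) ∩ B) ω
        have h2 := hprodb n ω
        rw [Real.norm_eq_abs]
        refine (abs_sub _ _).trans ?_
        linarith
      · filter_upwards [hmix, hgood, hinvκ] with ω hmω hgω hiω
        have hBω : MeasurableSet (Prod.mk ω ⁻¹' B) := measurable_prodMk_left hB
        set Bω := Prod.mk ω ⁻¹' B with hBωdef
        have hh := L1.integrable_coeFn (h ω)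
        have h0 := (hgω 0).1
        have hfi : Integrable (fun x => Bω.indicator (h ω) x - sec B ω * (h ω) x) m :=
          (hh.indicator hBω).sub (hh.const_mul _)
        set f : Lp ℝ 1 m := hfi.toL1 _ with hf
        have hfS : ∀ S, MeasurableSet S → ∫ x in S, f x ∂m
            = (κ ω).real (S ∩ Bω) - sec B ω * (κ ω).real S := by
          intro S hS
          have h1 : ∫ x in S, f x ∂m
              = ∫ x in S, (Bω.indicator (h ω) x - sec B ω * (h ω) x) ∂m :=
            integral_congr_ae (ae_restrict_of_ae hfi.coeFn_toL1)
          rw [h1, integral_sub (hh.indicator hBω).integrableOn (hh.const_mul _).integrableOn,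
            integral_const_mul, setIntegral_indicator hBω, hκr ω h0 _ (hS.inter hBω),
            hκr ω h0 _ hS]
        have hf0 : ∫ x, f x ∂m = 0 := by
          rw [← setIntegral_univ, hfS _ MeasurableSet.univ]
          simp [hsec, hBωdef]
        have hlim := hmω f hf0
          (F.indicator fun _ => indicatorConstLp ⊤ hE (measure_ne_top m E) (1 : ℝ))
          (stronglyMeasurable_const.indicator hF)
          ⟨_, fun ω' => norm_indicator_le_norm_self _ _⟩
        refine hlim.congr fun n => ?_
        have hs1 : sec (Θ^[n] ⁻¹' (F ×ˢ E) ∩ B) ω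
            = (κ ω).real (Tn n ω ⁻¹' (Prod.mk (σ^[n] ω) ⁻¹' (F ×ˢ E)) ∩ Bω) := by
          simp only [hsec]
          rw [Set.preimage_inter, hsecΘ]
        rw [hs1]
        by_cases hn : σ^[n] ω ∈ F
        · have hs2 : Prod.mk (σ^[n] ω) ⁻¹' (F ×ˢ E) = E := by
            ext x; simp [hn]
          have hs3 : sec (F ×ˢ E) (σ^[n] ω) = (κ ω).real (Tn n ω ⁻¹' E) := by
            simp only [hsec]
            rw [hs2, hiω n E hE]
          rw [hs3, hs2, mul_comm _ (sec B ω), ← hfS _ (hTnω n ω hE), ← hdual n ω f E hE,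
            ← integral_indicator hE, Set.indicator_of_mem hn]
          refine integral_congr_ae ?_
          have h2 : ∀ᵐ x ∂m, (indicatorConstLp ⊤ hE (measure_ne_top m E) (1 : ℝ)) x
            = E.indicator (fun _ => (1 : ℝ)) x := indicatorConstLp_coeFn
          filter_upwards [h2] with x hx
          rw [hx]; by_cases h : x ∈ E <;> simp [h]
        · have hs2 : Prod.mk (σ^[n] ω) ⁻¹' (F ×ˢ E) = ∅ := by
            ext x; simp [hn]
          have hs3 : sec (F ×ˢ E) (σ^[n] ω) = 0 := by
            simp only [hsec]
            rw [hs2]; simp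
          rw [hs3, hs2, Set.indicator_of_notMem hn]
          simp only [Set.preimage_empty, Set.empty_inter, measureReal_empty, zero_mul, sub_zero]
          rw [integral_eq_zero_of_ae]
          filter_upwards [Lp.coeFn_zero ℝ ⊤ m] with x hx
          rw [hx]; simp
    have := hD.add hM
    rw [zero_add] at this
    refine this.congr fun n => ?_
    rw [integral_sub (hseci _ (hmeasn n)) (hprodi n), hν _ (hmeasn n)]
    ring
  | compl A hA ih =>
    have h1 := ih.const_sub ((Pr.compProd κ).real B)
    have h2 : (Pr.compProd κ).real Aᶜ * (Pr.compProd κ).real B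
        = (Pr.compProd κ).real B - (Pr.compProd κ).real A * (Pr.compProd κ).real B := by
      rw [probReal_compl_eq_one_sub hA]; ring
    rw [h2]
    refine h1.congr fun n => ?_
    have h3 := measureReal_inter_add_sdiff (μ := Pr.compProd κ) (s := B) (hΘn n hA)
    have h4 : Θ^[n] ⁻¹' Aᶜ ∩ B = B \ Θ^[n] ⁻¹' A := by
      ext x; simp [and_comm]
    rw [h4, Set.inter_comm]
    linarith
  | iUnion A hd hA ih =>
    have hsum : ∀ S : ℕ → Set (Ω × X), Pairwise (Function.onFun Disjoint S) →
        (∀ i, MeasurableSet (S i)) → HasSum (fun i => (Pr.compProd κ).real (S i))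
          ((Pr.compProd κ).real (⋃ i, S i)) := by
      intro S hS hSm
      have h1 := measure_iUnion (μ := Pr.compProd κ) hS hSm
      have h2 : ∑' i, (Pr.compProd κ) (S i) ≠ ⊤ := h1 ▸ measure_ne_top _ _
      rw [Measure.real, h1, ENNReal.tsum_toReal_eq fun i => measure_ne_top _ _]
      exact ENNReal.hasSum_toReal h2
    have hAsum := hsum A hd hA
    rw [← (hAsum.mul_right _).tsum_eq]
    have hS : ∀ n, (Pr.compProd κ).real (Θ^[n] ⁻¹' (⋃ i, A i) ∩ B)
        = ∑' i, (Pr.compProd κ).real (Θ^[n] ⁻¹' (A i) ∩ B) := by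
      intro n
      rw [Set.preimage_iUnion, Set.iUnion_inter]
      refine (hsum _ ?_ fun i => (hΘn n (hA i)).inter hB).tsum_eq.symm
      intro i j hij
      exact ((hd hij).preimage _).mono Set.inter_subset_left Set.inter_subset_left
    simp only [hS]
    refine tendsto_tsum_of_dominated_convergence hAsum.summable ih
      (Eventually.of_forall fun n i => ?_)
    rw [Real.norm_eq_abs, abs_of_nonneg measureReal_nonneg, ← hνinv n _ (hA i)]
    exact measureReal_mono Set.inter_subset_left
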